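/- arXiv:2403.10445 — 2 statements merged into one kernel-verified Lean document; each statement's English description precedes it below -/
import Mathlib

section
/- Let (X,d) be a metric space, μ a Borel measure on X that is finite on bounded sets and satisfies μ(X \ supp μ) = 0, and let t, r > 0. Then the modified averaging operator A_{t,r,μ} is bounded on L¹(μ) if and only if a_{t,r,μ} ∈ L^∞(μ); moreover, the operator norm of A_{t,r,μ} on L¹(μ) equals the L^∞(μ)-norm of a_{t,r,μ}. Concretely: for every C ≥ 0, one has ‖A_{t,r,μ} f‖_{L¹(μ)} ≤ C‖f‖_{L¹(μ)} for all f ∈ L¹(μ) if and only if ‖a_{t,r,μ}‖_{L^∞(μ)} ≤ C. -/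
open MeasureTheory Metric Bornology ENNReal

/-- The support of a Borel measure: points all of whose open balls have positive measure. -/
def measSupport {X : Type*} [MetricSpace X] [MeasurableSpace X]
    (μ : Measure X) : Set X :=
  {x : X | ∀ r > 0, 0 < μ (Metric.ball x r)}

/-- The modified averaging operator
`A_{t,r,μ} f (x) = (1/μ(B(x,r))) ∫_{B(x,tr)} f dμ` (real-valued). -/
noncomputable def avgOp {X : Type*} [MetricSpace X] [MeasurableSpace X]
    (μ : Measure X) (t r : ℝ) (f : X → ℝ) (x : X) : ℝ :=
  (∫ y in Metric.closedBall x (t * r), f y ∂μ) /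
    (μ (Metric.closedBall x r)).toReal

/-- The conjugate function `a_{t,r,μ}(y) = ∫_X 1_{B(y,tr)}(x) / μ(B(x,r)) dμ(x)`. -/
noncomputable def conjFn {X : Type*} [MetricSpace X] [MeasurableSpace X]
    (μ : Measure X) (t r : ℝ) (y : X) : ℝ≥0∞ :=
  ∫⁻ x in Metric.closedBall y (t * r), (μ (Metric.closedBall x r))⁻¹ ∂μ

section AveragingOperator

variable {X : Type*} [MetricSpace X] [MeasurableSpace X]

theorem sigmaFinite_of_isBounded_lt_top (μ : Measure X)
    (hbdd : ∀ s : Set X, IsBounded s → μ s < ⊤) : SigmaFinite μ := by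
  rcases isEmpty_or_nonempty X with hX | ⟨⟨x₀⟩⟩
  · rw [Measure.eq_zero_of_isEmpty μ]
    infer_instance
  · exact ⟨⟨⟨fun n : ℕ => closedBall x₀ n, fun _ => trivial, fun n => hbdd _ isBounded_closedBall,
      iUnion_closedBall_nat x₀⟩⟩⟩

/-- A σ-finite measure has a separable support. -/
theorem exists_countable_dense_measSupport [OpensMeasurableSpace X] (μ : Measure X)
    [SigmaFinite μ] :
    ∃ D : Set X, D.Countable ∧ ∀ x ∈ measSupport μ, ∀ ε > 0, ∃ q ∈ D, dist x q < ε := by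
  have net : ∀ ε > 0, ∃ N : Set X, N.Countable ∧
      ∀ x ∈ measSupport μ, ∃ q ∈ N, dist x q < ε := by
    intro ε hε
    obtain ⟨N, hN⟩ := zorn_subset
      {N : Set X | N ⊆ measSupport μ ∧ N.Pairwise fun x y => ε ≤ dist x y} (fun c hc hchain =>
        ⟨⋃₀ c, ⟨Set.sUnion_subset fun s hs => (hc hs).1,
          (Set.pairwise_sUnion hchain.directedOn).2 fun s hs => (hc hs).2⟩,
          fun s hs => Set.subset_sUnion_of_mem hs⟩)
    refine ⟨N, ?_, fun x hx => ?_⟩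
    · have hcount := Measure.countable_meas_pos_of_disjoint_iUnion (μ := μ)
        (As := fun q : N => ball (q : X) (ε / 2)) (fun _ => measurableSet_ball)
        (fun p q hpq => ball_disjoint_ball (by
          have := hN.prop.2 p.2 q.2 (fun h => hpq (Subtype.ext h))
          linarith))
      have huniv : {q : N | 0 < μ (ball (q : X) (ε / 2))} = Set.univ :=
        Set.eq_univ_of_forall fun q => hN.prop.1 q.2 _ (half_pos hε)
      rw [huniv] at hcount
      exact Set.countable_coe_iff.1 (Set.countable_univ_iff.1 hcount)
    · by_contra! hfar
      have hmem : x ∈ N := hN.le_of_ge (y := insert x N)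
        ⟨Set.insert_subset hx hN.prop.1, hN.prop.2.insert fun y hy _ =>
          ⟨hfar y hy, by rw [dist_comm]; exact hfar y hy⟩⟩
        (Set.subset_insert x N) (Set.mem_insert x N)
      have := hfar x hmem
      rw [dist_self] at this
      linarith
  choose N hNc hN using fun n : ℕ => net (1 / ((n : ℝ) + 1)) Nat.one_div_pos_of_nat
  refine ⟨⋃ n, N n, Set.countable_iUnion hNc, fun x hx ε hε => ?_⟩
  obtain ⟨n, hn⟩ := exists_nat_one_div_lt hε
  obtain ⟨q, hq, hxq⟩ := hN n x hx
  exact ⟨q, Set.mem_iUnion.2 ⟨n, hq⟩, hxq.trans hn⟩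

/-- Near the support of `μ`, the relation `dist x y ≤ s` agrees with a set that is measurable for
the product σ-algebra, although `X` need not be second countable. -/
theorem exists_measurableSet_prod_dist_le [OpensMeasurableSpace X] (μ : Measure X)
    [SigmaFinite μ] (s : ℝ) :
    ∃ E : Set (X × X), MeasurableSet E ∧
      ∀ x ∈ measSupport μ, ∀ y, (x, y) ∈ E ↔ dist x y ≤ s := by
  obtain ⟨D, hDc, hD⟩ := exists_countable_dense_measSupport μ
  refine ⟨⋂ n : ℕ, ⋃ q ∈ D, ball q (1 / ((n : ℝ) + 1)) ×ˢ ball q (s + 1 / ((n : ℝ) + 1)),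
    MeasurableSet.iInter fun n => MeasurableSet.biUnion hDc fun q _ =>
      measurableSet_ball.prod measurableSet_ball, fun x hx y => ?_⟩
  simp only [Set.mem_iInter, Set.mem_iUnion, Set.mem_prod, mem_ball, exists_prop]
  constructor
  · intro h
    refine le_of_forall_pos_le_add fun ε hε => ?_
    obtain ⟨n, hn⟩ := exists_nat_one_div_lt (half_pos hε)
    obtain ⟨q, -, hxq, hyq⟩ := h n
    have := dist_triangle_right x y q
    linarith
  · intro h n
    have hn : 0 < 1 / ((n : ℝ) + 1) := Nat.one_div_pos_of_nat
    obtain ⟨q, hq, hxq⟩ := hD x hx _ hn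
    refine ⟨q, hq, hxq, ?_⟩
    have := dist_triangle_left y q x
    linarith

theorem enorm_avgOp {μ : Measure X} (hbdd : ∀ s : Set X, IsBounded s → μ s < ⊤)
    (t : ℝ) {r : ℝ} (hr : 0 < r) (f : X → ℝ) {x : X} (hx : x ∈ measSupport μ) :
    ‖avgOp μ t r f x‖ₑ =
      ‖∫ y in closedBall x (t * r), f y ∂μ‖ₑ * (μ (closedBall x r))⁻¹ := by
  have hpos : μ (closedBall x r) ≠ 0 :=
    ((hx r hr).trans_le (measure_mono ball_subset_closedBall)).ne'
  have hfin : μ (closedBall x r) ≠ ⊤ := (hbdd _ isBounded_closedBall).ne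
  rw [avgOp, div_eq_mul_inv, enorm_mul, enorm_inv (ENNReal.toReal_ne_zero.2 ⟨hpos, hfin⟩),
    Real.enorm_toReal hfin]

variable [BorelSpace X] {μ : Measure X}

theorem aemeasurable_measure_closedBall [SigmaFinite μ] (hsupp : μ (measSupport μ)ᶜ = 0) (r : ℝ) :
    AEMeasurable (fun x => μ (closedBall x r)) μ := by
  obtain ⟨E, hE, hEmem⟩ := exists_measurableSet_prod_dist_le μ r
  refine ⟨fun x => μ (Prod.mk x ⁻¹' E), measurable_measure_prodMk_left hE, ?_⟩
  filter_upwards [mem_ae_iff.2 hsupp] with x hx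
  congr 1
  ext y
  rw [Set.mem_preimage, hEmem x hx, mem_closedBall, dist_comm]

/-- The set integral over balls and the conjugate ball integral are adjoint to each other. -/
theorem lintegral_closedBall_swap [SigmaFinite μ] (hsupp : μ (measSupport μ)ᶜ = 0) (s : ℝ)
    {w h : X → ℝ≥0∞} (hw : Measurable w) (hh : AEMeasurable h μ) :
    ∫⁻ x, (∫⁻ y in closedBall x s, h y ∂μ) * w x ∂μ =
      ∫⁻ y, h y * ∫⁻ x in closedBall y s, w x ∂μ ∂μ := by
  obtain ⟨E, hE, hEmem⟩ := exists_measurableSet_prod_dist_le μ s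
  have hind : Measurable (E.indicator (1 : X × X → ℝ≥0∞)) := measurable_one.indicator hE
  calc ∫⁻ x, (∫⁻ y in closedBall x s, h y ∂μ) * w x ∂μ
      = ∫⁻ x, ∫⁻ y, E.indicator 1 (x, y) * w x * h y ∂μ ∂μ := by
        refine lintegral_congr_ae ?_
        filter_upwards [mem_ae_iff.2 hsupp] with x hx
        rw [← lintegral_indicator measurableSet_closedBall,
          ← lintegral_mul_const'' _ (hh.indicator measurableSet_closedBall)]
        refine lintegral_congr fun y => ?_
        by_cases hxy : dist x y ≤ s
        · have h1 : (x, y) ∈ E := (hEmem x hx y).2 hxy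
          have h2 : y ∈ closedBall x s := by rwa [mem_closedBall, dist_comm]
          simp [h1, h2, mul_comm]
        · have h1 : (x, y) ∉ E := fun h' => hxy ((hEmem x hx y).1 h')
          have h2 : y ∉ closedBall x s := by rwa [mem_closedBall, dist_comm]
          simp [h1, Set.indicator_of_notMem h2]
    _ = ∫⁻ y, ∫⁻ x, E.indicator 1 (x, y) * w x * h y ∂μ ∂μ :=
        lintegral_lintegral_swap
          ((hind.mul (hw.comp measurable_fst)).aemeasurable.mul hh.comp_snd)
    _ = ∫⁻ y, h y * ∫⁻ x in closedBall y s, w x ∂μ ∂μ := by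
        refine lintegral_congr fun y => ?_
        have hmeas : Measurable fun x => E.indicator (1 : X × X → ℝ≥0∞) (x, y) * w x :=
          (hind.comp measurable_prodMk_right).mul hw
        rw [lintegral_mul_const _ hmeas, mul_comm,
          ← lintegral_indicator measurableSet_closedBall]
        congr 1
        refine lintegral_congr_ae ?_
        filter_upwards [mem_ae_iff.2 hsupp] with x hx
        by_cases hxy : dist x y ≤ s
        · have h1 : (x, y) ∈ E := (hEmem x hx y).2 hxy
          have h2 : x ∈ closedBall y s := hxy
          simp [h1, h2]
        · have h1 : (x, y) ∉ E := fun h' => hxy ((hEmem x hx y).1 h')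
          have h2 : x ∉ closedBall y s := hxy
          simp [h1, Set.indicator_of_notMem h2]

theorem measurable_lintegral_closedBall [SigmaFinite μ] (hsupp : μ (measSupport μ)ᶜ = 0) (s : ℝ)
    {w : X → ℝ≥0∞} (hw : Measurable w) :
    Measurable fun y => ∫⁻ x in closedBall y s, w x ∂μ := by
  obtain ⟨E, hE, hEmem⟩ := exists_measurableSet_prod_dist_le μ s
  have hind : Measurable (E.indicator fun p : X × X => w p.1) :=
    (hw.comp measurable_fst).indicator hE
  convert hind.lintegral_prod_left' (μ := μ) using 2 with y
  rw [← lintegral_indicator measurableSet_closedBall]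
  refine lintegral_congr_ae ?_
  filter_upwards [mem_ae_iff.2 hsupp] with x hx
  have : x ∈ closedBall y s ↔ (x, y) ∈ E := (hEmem x hx y).symm
  by_cases hxy : x ∈ closedBall y s
  · rw [Set.indicator_of_mem hxy, Set.indicator_of_mem (this.1 hxy)]
  · rw [Set.indicator_of_notMem hxy, Set.indicator_of_notMem (mt this.2 hxy)]

theorem measurable_conjFn [SigmaFinite μ] (hsupp : μ (measSupport μ)ᶜ = 0) (t r : ℝ) :
    Measurable (conjFn μ t r) := by
  have hm := (aemeasurable_measure_closedBall hsupp r).inv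
  have heq : conjFn μ t r = fun y => ∫⁻ x in closedBall y (t * r), hm.mk _ x ∂μ :=
    funext fun y => lintegral_congr_ae (ae_restrict_of_ae hm.ae_eq_mk)
  rw [heq]
  exact measurable_lintegral_closedBall hsupp _ hm.measurable_mk

theorem lintegral_avg_eq_lintegral_mul_conjFn [SigmaFinite μ] (hsupp : μ (measSupport μ)ᶜ = 0)
    (t r : ℝ) {h : X → ℝ≥0∞} (hh : AEMeasurable h μ) :
    ∫⁻ x, (∫⁻ y in closedBall x (t * r), h y ∂μ) * (μ (closedBall x r))⁻¹ ∂μ =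
      ∫⁻ y, h y * conjFn μ t r y ∂μ := by
  have hm := (aemeasurable_measure_closedBall hsupp r).inv
  have heq : conjFn μ t r = fun y => ∫⁻ x in closedBall y (t * r), hm.mk _ x ∂μ :=
    funext fun y => lintegral_congr_ae (ae_restrict_of_ae hm.ae_eq_mk)
  rw [heq, ← lintegral_closedBall_swap hsupp _ hm.measurable_mk hh]
  refine lintegral_congr_ae ?_
  filter_upwards [hm.ae_eq_mk] with x hx
  rw [← hx, Pi.inv_apply]

end AveragingOperator

theorem stmt1 {X : Type*} [MetricSpace X] [MeasurableSpace X] [BorelSpace X]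
    (μ : Measure X)
    (hbdd : ∀ s : Set X, IsBounded s → μ s < ⊤)
    (hsupp : μ (measSupport μ)ᶜ = 0)
    (t r : ℝ) (ht : 0 < t) (hr : 0 < r)
    (C : ℝ) (hC : 0 ≤ C) :
    (∀ f : X → ℝ, Integrable f μ →
        eLpNorm (avgOp μ t r f) 1 μ ≤ ENNReal.ofReal C * eLpNorm f 1 μ)
      ↔ essSup (conjFn μ t r) μ ≤ ENNReal.ofReal C := by
  have := sigmaFinite_of_isBounded_lt_top μ hbdd
  constructor
  · intro hA
    refine essSup_le_of_ae_le _ (ae_le_of_forall_setLIntegral_le_of_sigmaFinite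
      (measurable_conjFn hsupp t r) fun A hAm hAfin => ?_)
    have hind : Measurable (A.indicator (1 : X → ℝ≥0∞)) := measurable_one.indicator hAm
    have key := hA (A.indicator 1) ((integrable_indicator_iff hAm).2
      (integrableOn_const hAfin.ne))
    have hnorm : eLpNorm (A.indicator (1 : X → ℝ)) 1 μ = μ A := by
      simp [eLpNorm_one_eq_lintegral_enorm, enorm_indicator_eq_indicator_enorm,
        lintegral_indicator hAm]
    have havg : eLpNorm (avgOp μ t r (A.indicator 1)) 1 μ = ∫⁻ y in A, conjFn μ t r y ∂μ := by
      rw [eLpNorm_one_eq_lintegral_enorm, ← lintegral_indicator hAm]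
      have hmul : ∀ y, A.indicator (conjFn μ t r) y = A.indicator 1 y * conjFn μ t r y :=
        fun y => by by_cases hy : y ∈ A <;> simp [hy]
      simp_rw [hmul]
      rw [← lintegral_avg_eq_lintegral_mul_conjFn hsupp t r hind.aemeasurable]
      refine lintegral_congr_ae ?_
      filter_upwards [mem_ae_iff.2 hsupp] with x hx
      rw [enorm_avgOp hbdd t hr _ hx, integral_indicator_one hAm, lintegral_indicator_one hAm,
        Measure.real, Real.enorm_toReal]
      exact ((Measure.restrict_apply_le _ _).trans_lt hAfin).ne
    rw [hnorm, havg] at key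
    simpa using key
  · intro hess f hf
    have hle : ∀ᵐ y ∂μ, conjFn μ t r y ≤ ENNReal.ofReal C :=
      (ae_le_essSup (conjFn μ t r)).mono fun y hy => hy.trans hess
    simp only [eLpNorm_one_eq_lintegral_enorm]
    calc ∫⁻ x, ‖avgOp μ t r f x‖ₑ ∂μ
        ≤ ∫⁻ x, (∫⁻ y in closedBall x (t * r), ‖f y‖ₑ ∂μ) * (μ (closedBall x r))⁻¹ ∂μ := by
          refine lintegral_mono_ae ?_
          filter_upwards [mem_ae_iff.2 hsupp] with x hx
          rw [enorm_avgOp hbdd t hr f hx]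
          gcongr
          exact enorm_integral_le_lintegral_enorm _
      _ = ∫⁻ y, ‖f y‖ₑ * conjFn μ t r y ∂μ :=
          lintegral_avg_eq_lintegral_mul_conjFn hsupp t r hf.aestronglyMeasurable.enorm
      _ ≤ ∫⁻ y, ENNReal.ofReal C * ‖f y‖ₑ ∂μ := by
          refine lintegral_mono_ae ?_
          filter_upwards [hle] with y hy
          rw [mul_comm]
          gcongr
      _ = ENNReal.ofReal C * ∫⁻ y, ‖f y‖ₑ ∂μ :=
          lintegral_const_mul' _ _ ENNReal.ofReal_ne_top
end

section
/- Let (X,d) be a metric space, μ a Borel measure on X that is finite on bounded sets and satisfies μ(X \ supp μ) = 0, let r > 0 and let t ∈ (0, 1/2]. Then a_{t,r,μ}(y) ≤ 1 for every y ∈ X, and consequently ‖A_{t,r,μ} f‖_{L¹(μ)} ≤ ‖f‖_{L¹(μ)} for every f ∈ L¹(μ). -/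
open MeasureTheory Metric Bornology ENNReal

/-- A measure on a metric space that is finite on bounded sets is σ-finite. -/
theorem sigmaFinite_of_isBounded {X : Type*} [MetricSpace X] [MeasurableSpace X]
    (μ : Measure X) (hbdd : ∀ s : Set X, IsBounded s → μ s < ⊤) : SigmaFinite μ := by
  rcases isEmpty_or_nonempty X with hX | ⟨⟨x₀⟩⟩
  · rw [Measure.eq_zero_of_isEmpty μ]
    infer_instance
  · exact ⟨⟨⟨fun n : ℕ => Metric.closedBall x₀ n, fun _ => trivial,
      fun _ => hbdd _ Metric.isBounded_closedBall, Metric.iUnion_closedBall_nat x₀⟩⟩⟩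

/-- The support of an s-finite Borel measure lies in the closure of a countable set. -/
theorem exists_countable_measSupport_subset_closure {X : Type*} [MetricSpace X]
    [MeasurableSpace X] [BorelSpace X] (μ : Measure X) [SFinite μ] :
    ∃ D : Set X, D.Countable ∧ measSupport μ ⊆ closure D := by
  have key : ∀ ε > 0, ∃ u : Set X, u.Countable ∧
      measSupport μ ⊆ ⋃ x ∈ u, Metric.closedBall x (4 * ε) := by
    intro ε hε
    obtain ⟨u, hu, hdisj, hcov⟩ :=
      Vitali.exists_disjoint_subfamily_covering_enlargement_closedBall (measSupport μ)
        (fun x : X => x) (fun _ => ε) ε (fun _ _ => le_rfl) 4 (by norm_num)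
    refine ⟨u, ?_, fun x hx => ?_⟩
    · have hc := Measure.countable_meas_pos_of_disjoint_iUnion (μ := μ)
        (As := fun x : u => Metric.closedBall (x : X) ε)
        (fun _ => Metric.isClosed_closedBall.measurableSet)
        (fun a b hab => hdisj a.2 b.2 (fun h => hab (Subtype.ext h)))
      have huniv : {x : u | 0 < μ (Metric.closedBall (x : X) ε)} = Set.univ :=
        Set.eq_univ_of_forall fun x =>
          (hu x.2 ε hε).trans_le (measure_mono Metric.ball_subset_closedBall)
      rw [huniv] at hc
      exact Set.countable_univ_iff.1 hc
    · obtain ⟨b, hb, hsub⟩ := hcov x hx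
      exact Set.mem_biUnion hb (hsub (Metric.mem_closedBall_self hε.le))
  choose! u huc hus using key
  refine ⟨⋃ n : ℕ, u (1 / ((n : ℝ) + 1)), Set.countable_iUnion fun n => huc _ (by positivity),
    fun x hx => Metric.mem_closure_iff.2 fun ε hε => ?_⟩
  obtain ⟨n, hn⟩ := exists_nat_one_div_lt (show 0 < ε / 4 by positivity)
  obtain ⟨b, hb, hxb⟩ := Set.mem_iUnion₂.1 (hus (1 / ((n : ℝ) + 1)) (by positivity) hx)
  refine ⟨b, Set.mem_iUnion.2 ⟨n, hb⟩, ?_⟩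
  have := Metric.mem_closedBall.1 hxb
  linarith

/-- Although the distance need not be measurable for the product σ-algebra, its sublevel sets
are, once one coordinate is confined to the closure of a countable set. -/
theorem measurableSet_closure_dist_le {X : Type*} [MetricSpace X] [MeasurableSpace X]
    [BorelSpace X] {D : Set X} (hD : D.Countable) (c : ℝ) :
    MeasurableSet {p : X × X | p.1 ∈ closure D ∧ dist p.1 p.2 ≤ c} := by
  have heq : {p : X × X | p.1 ∈ closure D ∧ dist p.1 p.2 ≤ c} =
      ⋂ n : ℕ, ⋃ q ∈ D, Metric.ball q (1 / ((n : ℝ) + 1)) ×ˢ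
        Metric.ball q (c + 1 / ((n : ℝ) + 1)) := by
    ext ⟨x, y⟩
    simp only [Set.mem_ofPred_eq, Set.mem_iInter, Set.mem_iUnion, Set.mem_prod, Metric.mem_ball,
      exists_prop]
    constructor
    · rintro ⟨hx, hxy⟩ n
      obtain ⟨q, hq, hxq⟩ := Metric.mem_closure_iff.1 hx (1 / ((n : ℝ) + 1)) (by positivity)
      refine ⟨q, hq, hxq, ?_⟩
      have := dist_triangle_left y q x
      linarith
    · intro h
      refine ⟨Metric.mem_closure_iff.2 fun ε hε => ?_, le_of_forall_pos_lt_add fun ε hε => ?_⟩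
      · obtain ⟨n, hn⟩ := exists_nat_one_div_lt hε
        obtain ⟨q, hq, hxq, -⟩ := h n
        exact ⟨q, hq, hxq.trans hn⟩
      · obtain ⟨n, hn⟩ := exists_nat_one_div_lt (half_pos hε)
        obtain ⟨q, -, hxq, hyq⟩ := h n
        have := dist_triangle_right x y q
        linarith
  rw [heq]
  exact MeasurableSet.iInter fun n => MeasurableSet.biUnion hD fun q _ =>
    Metric.isOpen_ball.measurableSet.prod Metric.isOpen_ball.measurableSet

/-- For `t ≤ 1 / 2` the conjugate function is bounded by `1`. -/
theorem conjFn_le_one {X : Type*} [MetricSpace X] [MeasurableSpace X] [BorelSpace X]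
    (μ : Measure X) {t r : ℝ} (ht : t ≤ 1 / 2) (hr : 0 ≤ r) (y : X) : conjFn μ t r y ≤ 1 := by
  calc conjFn μ t r y
      ≤ ∫⁻ _ in Metric.closedBall y (t * r), (μ (Metric.closedBall y (t * r)))⁻¹ ∂μ := by
        refine setLIntegral_mono' Metric.isClosed_closedBall.measurableSet fun x hx => ?_
        refine ENNReal.inv_le_inv.2 (measure_mono (Metric.closedBall_subset_closedBall' ?_))
        have := Metric.mem_closedBall'.1 hx
        nlinarith
    _ ≤ 1 := by
        rw [setLIntegral_const]
        exact ENNReal.inv_mul_le_one _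

/-- Pointwise bound of the averaging operator by the average of the norm. -/
theorem enorm_avgOp_le {X : Type*} [MetricSpace X] [MeasurableSpace X]
    (μ : Measure X) (hbdd : ∀ s : Set X, IsBounded s → μ s < ⊤) (t r : ℝ) (f : X → ℝ) (x : X) :
    ‖avgOp μ t r f x‖ₑ ≤
      (μ (Metric.closedBall x r))⁻¹ * ∫⁻ y in Metric.closedBall x (t * r), ‖f y‖ₑ ∂μ := by
  rcases eq_or_ne (μ (Metric.closedBall x r)) 0 with h0 | h0
  · simp [avgOp, h0]
  · have hfin := (hbdd _ (Metric.isBounded_closedBall (x := x) (r := r))).ne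
    rw [avgOp, div_eq_inv_mul, enorm_mul, enorm_inv (ENNReal.toReal_ne_zero.2 ⟨h0, hfin⟩),
      Real.enorm_of_nonneg ENNReal.toReal_nonneg, ENNReal.ofReal_toReal hfin]
    gcongr
    exact enorm_integral_le_lintegral_enorm _

/-- The `L¹` norm of an average is at most the integral of the function against the conjugate
function. -/
theorem lintegral_enorm_avgOp_le {X : Type*} [MetricSpace X] [MeasurableSpace X] [BorelSpace X]
    (μ : Measure X) (hbdd : ∀ s : Set X, IsBounded s → μ s < ⊤)
    (hsupp : μ (measSupport μ)ᶜ = 0) (t r : ℝ) {f : X → ℝ} (hf : AEStronglyMeasurable f μ) :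
    ∫⁻ x, ‖avgOp μ t r f x‖ₑ ∂μ ≤ ∫⁻ y, conjFn μ t r y * ‖f y‖ₑ ∂μ := by
  have := sigmaFinite_of_isBounded μ hbdd
  obtain ⟨D, hD, hsub⟩ := exists_countable_measSupport_subset_closure μ
  have hae : ∀ᵐ x ∂μ, x ∈ closure D :=
    measure_mono_null (Set.compl_subset_compl.2 hsub) hsupp
  let E : ℝ → Set (X × X) := fun c => {p | p.1 ∈ closure D ∧ dist p.1 p.2 ≤ c}
  have hE (c : ℝ) : MeasurableSet (E c) := measurableSet_closure_dist_le hD c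
  have hfib {x : X} (hx : x ∈ closure D) (c : ℝ) :
      Prod.mk x ⁻¹' E c = Metric.closedBall x c := by
    ext y
    simp [E, hx, dist_comm]
  let w : X → ℝ≥0∞ := fun x => (μ (Prod.mk x ⁻¹' E r))⁻¹
  have hw : Measurable w := (measurable_measure_prodMk_left (hE r)).inv
  let h : X → X → ℝ≥0∞ := fun x y =>
    (E (t * r)).indicator (fun p => w p.1 * ‖f p.2‖ₑ) (x, y)
  have hh : AEMeasurable (Function.uncurry h) (μ.prod μ) :=
    ((hw.comp measurable_fst).aemeasurable.mul
      (AEMeasurable.comp_snd hf.enorm)).indicator (hE (t * r))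
  calc ∫⁻ x, ‖avgOp μ t r f x‖ₑ ∂μ
      ≤ ∫⁻ x, ∫⁻ y, h x y ∂μ ∂μ := by
        refine lintegral_mono_ae (hae.mono fun x hx => (enorm_avgOp_le μ hbdd t r f x).trans ?_)
        refine (lintegral_const_mul_le _ _).trans_eq ?_
        rw [← lintegral_indicator Metric.isClosed_closedBall.measurableSet, ← hfib hx,
          ← hfib hx]
        rfl
    _ = ∫⁻ y, ∫⁻ x, h x y ∂μ ∂μ := lintegral_lintegral_swap hh
    _ ≤ ∫⁻ y, conjFn μ t r y * ‖f y‖ₑ ∂μ := by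
        refine lintegral_mono fun y => ?_
        rw [conjFn, ← lintegral_mul_const' _ _ enorm_ne_top,
          ← lintegral_indicator Metric.isClosed_closedBall.measurableSet]
        refine lintegral_mono fun x => Set.indicator_apply_le' (fun hxy => ?_) fun _ => zero_le
        rw [Set.indicator_of_mem (Metric.mem_closedBall.2 hxy.2)]
        simp only [w, hfib hxy.1, le_refl]

theorem stmt2 {X : Type*} [MetricSpace X] [MeasurableSpace X] [BorelSpace X]
    (μ : Measure X)
    (hbdd : ∀ s : Set X, IsBounded s → μ s < ⊤)
    (hsupp : μ (measSupport μ)ᶜ = 0)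
    (t r : ℝ) (ht : 0 < t) (ht' : t ≤ 1 / 2) (hr : 0 < r) :
    (∀ y : X, conjFn μ t r y ≤ 1) ∧
      ∀ f : X → ℝ, Integrable f μ →
        eLpNorm (avgOp μ t r f) 1 μ ≤ eLpNorm f 1 μ := by
  refine ⟨conjFn_le_one μ ht' hr.le, fun f hf => ?_⟩
  rw [eLpNorm_one_eq_lintegral_enorm, eLpNorm_one_eq_lintegral_enorm]
  refine (lintegral_enorm_avgOp_le μ hbdd hsupp t r hf.aestronglyMeasurable).trans ?_
  exact lintegral_mono fun y => mul_le_of_le_one_left' (conjFn_le_one μ ht' hr.le y)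
end
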